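/- Let 1 < p < ∞ and 1/p − 1 < γ < 1/p, and let λ = (λ_n)_{n≥1} be a nonnegative sequence in the class GBV. If ∑_{n=1}^∞ n^{p+pγ−2} ( ∑_{k=n}^∞ k^{−1} λ_k )^p < ∞, then ∑_{n=1}^∞ n^{p+pγ−2} λ_n^p < ∞; moreover there is a constant C > 0 (depending only on λ, p and γ) such that ∑_{n=2}^∞ n^{p+pγ−2} λ_n^p ≤ C ∑_{n=1}^∞ n^{p+pγ−2} ( ∑_{k=n}^∞ k^{−1} λ_k )^p. -/

import Mathlib

open Filter

/-- A sequence of generalized bounded variation is quasi-decreasing on dyadic blocks. -/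
lemma le_mul_of_sum_abs_sub_le {lam : ℕ → ℝ} {M : ℝ} {m n : ℕ}
    (hM : ∑ k ∈ Finset.Icc m (2 * m), |lam k - lam (k + 1)| ≤ M * lam m)
    (hmn : m ≤ n) (hn : n ≤ 2 * m + 1) : lam n ≤ (1 + M) * lam m := by
  have h1 : |lam m - lam n| ≤ ∑ k ∈ Finset.Ico m n, |lam k - lam (k + 1)| := by
    simpa only [Real.dist_eq] using dist_le_Ico_sum_dist lam hmn
  have h2 : ∑ k ∈ Finset.Ico m n, |lam k - lam (k + 1)| ≤
      ∑ k ∈ Finset.Icc m (2 * m), |lam k - lam (k + 1)| := by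
    refine Finset.sum_le_sum_of_subset_of_nonneg (fun k hk => ?_) fun _ _ _ => abs_nonneg _
    simp only [Finset.mem_Ico, Finset.mem_Icc] at hk ⊢
    omega
  linarith [neg_abs_le (lam m - lam n)]

/-- A term of a sequence of generalized bounded variation is controlled by the tail sums
of `k⁻¹ λ_k`. -/
lemma ofReal_le_mul_tsum_inv_mul {lam : ℕ → ℝ} (hnn : ∀ n, 0 ≤ lam n) {M : ℝ} (hM0 : 0 < M)
    (hM : ∀ m : ℕ, 1 ≤ m →
      ∑ n ∈ Finset.Icc m (2 * m), |lam n - lam (n + 1)| ≤ M * lam m)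
    {m n : ℕ} (hm : 1 ≤ m) (hmn : 2 * m ≤ n) (hn : n ≤ 2 * m + 1) :
    ENNReal.ofReal (lam n) ≤ ENNReal.ofReal (2 * (1 + M)) *
      ∑' k : ℕ, ENNReal.ofReal (((m + k : ℕ) : ℝ)⁻¹ * lam (m + k)) := by
  have hn0 : (0 : ℝ) < n := by exact_mod_cast (by omega : 0 < n)
  have hterm : ∀ k ∈ Finset.range (n - m + 1),
      (n : ℝ)⁻¹ * ((1 + M)⁻¹ * lam n) ≤ ((m + k : ℕ) : ℝ)⁻¹ * lam (m + k) := by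
    intro k hk
    rw [Finset.mem_range] at hk
    have hk0 : (0 : ℝ) < (m + k : ℕ) := by exact_mod_cast (by omega : 0 < m + k)
    have hkn : ((m + k : ℕ) : ℝ) ≤ n := by exact_mod_cast (by omega : m + k ≤ n)
    have hl := le_mul_of_sum_abs_sub_le (hM (m + k) (by omega))
      (by omega : m + k ≤ n) (by omega)
    have hl' : (1 + M)⁻¹ * lam n ≤ lam (m + k) := by
      rwa [inv_mul_le_iff₀ (by positivity)]
    exact mul_le_mul (inv_anti₀ hk0 hkn) hl'
      (mul_nonneg (by positivity) (hnn n)) (by positivity)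
  have hsum := Finset.sum_le_sum hterm
  rw [Finset.sum_const, Finset.card_range, nsmul_eq_mul] at hsum
  have hcard : (n : ℝ) ≤ 2 * ((n - m + 1 : ℕ) : ℝ) := by
    exact_mod_cast (by omega : n ≤ 2 * (n - m + 1))
  have hbound : lam n ≤ 2 * (1 + M) *
      ∑ k ∈ Finset.range (n - m + 1), ((m + k : ℕ) : ℝ)⁻¹ * lam (m + k) := by
    refine le_trans ?_ (mul_le_mul_of_nonneg_left hsum (by positivity))
    have : 2 * (1 + M) * (((n - m + 1 : ℕ) : ℝ) * ((n : ℝ)⁻¹ * ((1 + M)⁻¹ * lam n))) =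
        (2 * ((n - m + 1 : ℕ) : ℝ) / n) * lam n := by
      field_simp
    rw [this]
    exact le_mul_of_one_le_left (hnn n) ((one_le_div hn0).2 hcard)
  refine (ENNReal.ofReal_le_ofReal hbound).trans ?_
  rw [ENNReal.ofReal_mul (by positivity),
    ENNReal.ofReal_sum_of_nonneg fun k _ => mul_nonneg (by positivity) (hnn _)]
  gcongr
  exact ENNReal.sum_le_tsum _

lemma rpow_le_three_rpow_abs_mul (a : ℝ) {x y : ℝ} (hx : 0 < x) (hxy : x ≤ y) (hy : y ≤ 3 * x) :
    y ^ a ≤ 3 ^ |a| * x ^ a := by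
  rcases le_total 0 a with ha | ha
  · rw [abs_of_nonneg ha, ← Real.mul_rpow (by norm_num) hx.le]
    exact Real.rpow_le_rpow (hx.le.trans hxy) hy ha
  · exact (Real.rpow_le_rpow_of_nonpos hx hxy ha).trans <|
      le_mul_of_one_le_left (by positivity) (Real.one_le_rpow (by norm_num) (abs_nonneg a))

lemma ENNReal.tsum_comp_div_two (g : ℕ → ENNReal) : ∑' i, g (i / 2) = 2 * ∑' j, g j := by
  rw [← tsum_even_add_odd ENNReal.summable ENNReal.summable, two_mul]
  congr 2
  · ext j
    congr 1
    omega
  · ext j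
    congr 1
    omega

/-- The weighted `ℓ^p` bound for a sequence of generalized bounded variation by its tail sums. -/
lemma tsum_rpow_mul_le_of_gbv {lam : ℕ → ℝ} (hnn : ∀ n, 0 ≤ lam n) {M : ℝ} (hM0 : 0 < M)
    (hM : ∀ m : ℕ, 1 ≤ m →
      ∑ n ∈ Finset.Icc m (2 * m), |lam n - lam (n + 1)| ≤ M * lam m)
    {p : ℝ} (hp : 0 ≤ p) (a : ℝ) :
    ∑' n : ℕ, ENNReal.ofReal (((n + 2 : ℕ) : ℝ) ^ a * lam (n + 2) ^ p) ≤
      ENNReal.ofReal (2 * (3 ^ |a| * (2 * (1 + M)) ^ p)) *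
        ∑' n : ℕ, ENNReal.ofReal (((n + 1 : ℕ) : ℝ) ^ a) *
          (∑' k : ℕ, ENNReal.ofReal (((n + 1 + k : ℕ) : ℝ)⁻¹ * lam (n + 1 + k))) ^ p := by
  rw [ENNReal.ofReal_mul zero_le_two, ENNReal.ofReal_ofNat, mul_assoc, mul_left_comm,
    ← ENNReal.tsum_comp_div_two, ← ENNReal.tsum_mul_left]
  refine ENNReal.tsum_le_tsum fun i => ?_
  have hw : ((i + 2 : ℕ) : ℝ) ^ a ≤ 3 ^ |a| * ((i / 2 + 1 : ℕ) : ℝ) ^ a := by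
    refine rpow_le_three_rpow_abs_mul a (by positivity) ?_ ?_
    · exact_mod_cast (by omega : i / 2 + 1 ≤ i + 2)
    · exact_mod_cast (by omega : i + 2 ≤ 3 * (i / 2 + 1))
  have hl := ofReal_le_mul_tsum_inv_mul hnn hM0 hM
    (by omega : 1 ≤ i / 2 + 1) (by omega : 2 * (i / 2 + 1) ≤ i + 2) (by omega)
  rw [ENNReal.ofReal_mul (by positivity), ← ENNReal.ofReal_rpow_of_nonneg (hnn _) hp]
  refine (mul_le_mul' (ENNReal.ofReal_le_ofReal hw) (ENNReal.rpow_le_rpow hl hp)).trans_eq ?_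
  rw [ENNReal.mul_rpow_of_nonneg _ _ hp, ENNReal.ofReal_rpow_of_nonneg (by positivity) hp,
    ENNReal.ofReal_mul (by positivity), ENNReal.ofReal_mul (by positivity),
    mul_mul_mul_comm]

/-- Necessity step of Theorem 1.3: for `λ ∈ GBV`, if
`∑ n^{p+pγ-2} (∑_{k≥n} k⁻¹ λ_k)^p < ∞` then `∑ n^{p+pγ-2} λ_n^p < ∞`, with the
quantitative bound `∑_{n≥2} n^{p+pγ-2} λ_n^p ≤ C ∑_{n≥1} n^{p+pγ-2} (∑_{k≥n} k⁻¹ λ_k)^p`. -/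
theorem stmt_10 (p γ : ℝ) (hp1 : 1 < p) (hγ1 : 1 / p - 1 < γ) (hγ2 : γ < 1 / p)
    (lam : ℕ → ℝ) (hnn : ∀ n, 0 ≤ lam n) (hlim : Tendsto lam atTop (nhds 0))
    (hGBV : ∃ M : ℝ, 0 < M ∧ ∀ m : ℕ, 1 ≤ m →
      ∑ n ∈ Finset.Icc m (2 * m), |lam n - lam (n + 1)| ≤ M * lam m)
    (hfin : ∑' n : ℕ, ENNReal.ofReal (((n + 1 : ℕ) : ℝ) ^ (p + p * γ - 2)) *
        (∑' k : ℕ, ENNReal.ofReal (((n + 1 + k : ℕ) : ℝ)⁻¹ * lam (n + 1 + k))) ^ p ≠ ⊤) :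
    Summable (fun n : ℕ => ((n + 1 : ℕ) : ℝ) ^ (p + p * γ - 2) * lam (n + 1) ^ p) ∧
      ∃ C : ℝ, 0 < C ∧
        ∑' n : ℕ, ENNReal.ofReal (((n + 2 : ℕ) : ℝ) ^ (p + p * γ - 2) * lam (n + 2) ^ p) ≤
          ENNReal.ofReal C *
            ∑' n : ℕ, ENNReal.ofReal (((n + 1 : ℕ) : ℝ) ^ (p + p * γ - 2)) *
              (∑' k : ℕ, ENNReal.ofReal (((n + 1 + k : ℕ) : ℝ)⁻¹ * lam (n + 1 + k))) ^ p := by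
  obtain ⟨M, hM0, hM⟩ := hGBV
  have hp : 0 ≤ p := by linarith
  have hle := tsum_rpow_mul_le_of_gbv hnn hM0 hM hp (p + p * γ - 2)
  refine ⟨?_, _, by positivity, hle⟩
  rw [← summable_nat_add_iff 1]
  have hsum := ENNReal.summable_toReal
    (ne_top_of_le_ne_top (ENNReal.mul_ne_top ENNReal.ofReal_ne_top hfin) hle)
  refine hsum.congr fun n => ?_
  exact ENNReal.toReal_ofReal (mul_nonneg (by positivity) (Real.rpow_nonneg (hnn _) _))
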